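/- For each j ∈ {1, 2, 4, 8}, the following almost sure convergence holds as N → ∞: ξ^j_N → A₁ a² (2^{2H₁} − 1) j^{2H₁} + A₂ b² (2^{2H₂} − 1) j^{2H₂}, where A_i = 2h^{2H_i} / ((2H_i + 1)(H_i + 1)), i = 1, 2; moreover this limit equals E[ξ^j_1] = E[(X̃_1^{jh} − X̃_0^{jh})²]. -/

import Mathlib

open MeasureTheory ProbabilityTheory Filter Real Matrix Topology

noncomputable section

variable {Ω : Type*} [MeasurableSpace Ω]

/-- A (centered) fractional Brownian motion with Hurst index `H` on the probability space
`(Ω, P)`: a jointly measurable process with a.s. continuous sample paths, whose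
finite-dimensional distributions are centered Gaussian (equivalently, every finite linear
combination of values of the process is a centered real Gaussian random variable), with
covariance `E[W_s W_t] = (s^{2H} + t^{2H} - |s-t|^{2H})/2` for `s, t ≥ 0`. -/
structure IsFBM (P : Measure Ω) (H : ℝ) (W : ℝ → Ω → ℝ) : Prop where
  jointMeasurable : Measurable (Function.uncurry W)
  gaussian_fdd : ∀ (n : ℕ) (t : Fin n → ℝ), (∀ i, 0 ≤ t i) → ∀ c : Fin n → ℝ,
    ∃ v : NNReal, P.map (fun ω => ∑ i, c i * W (t i) ω) = gaussianReal 0 v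
  cov : ∀ s t : ℝ, 0 ≤ s → 0 ≤ t →
    ∫ ω, W s ω * W t ω ∂P = (s ^ (2*H) + t ^ (2*H) - |s - t| ^ (2*H)) / 2
  cont : ∀ᵐ ω ∂P, Continuous fun t => W t ω

/-- The normalized integrated fractional Brownian motion (nifBm) with window `h`:
`X_t^{h,H} = (1/h) ∫_t^{t+h} W_u du`. -/
def nifBm (W : ℝ → Ω → ℝ) (h t : ℝ) (ω : Ω) : ℝ := (1/h) * ∫ u in t..(t+h), W u ω

/-- The function `γ(H, n)`. -/
def gam (H : ℝ) (n : ℤ) : ℝ :=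
  (|(n:ℝ) - 2| ^ (2*H+2) - 4 * |(n:ℝ) - 1| ^ (2*H+2) + 6 * |(n:ℝ)| ^ (2*H+2)
    - 4 * |(n:ℝ) + 1| ^ (2*H+2) + |(n:ℝ) + 2| ^ (2*H+2)) / (4 * (2*H+1) * (H+1))

/-- `log₊ x = log x` for `x > 0` and `0` otherwise. -/
def logpos (x : ℝ) : ℝ := if 0 < x then Real.log x else 0

/-- `X̃_k^{jh} = a X_{k·jh}^{jh,H₁} + b X_{k·jh}^{jh,H₂}`. -/
def tXj (W₁ W₂ : ℝ → Ω → ℝ) (a b h : ℝ) (j k : ℕ) (ω : Ω) : ℝ :=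
  a * nifBm W₁ ((j:ℝ)*h) ((k:ℝ)*((j:ℝ)*h)) ω + b * nifBm W₂ ((j:ℝ)*h) ((k:ℝ)*((j:ℝ)*h)) ω

/-- The statistic `ξ^j_N = (1/N) ∑_{k=0}^{N-1} (X̃_{k+1}^{jh} - X̃_k^{jh})²`. -/
def xiTwo (W₁ W₂ : ℝ → Ω → ℝ) (a b h : ℝ) (j N : ℕ) (ω : Ω) : ℝ :=
  (1/(N:ℝ)) * ∑ k ∈ Finset.range N,
    (tXj W₁ W₂ a b h j (k+1) ω - tXj W₁ W₂ a b h j k ω)^2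

/-- The fourth moment of a centered real Gaussian. -/
lemma integral_pow_four_gaussianReal (v : NNReal) :
    ∫ x, x ^ 4 ∂(gaussianReal 0 v) = 3 * (v : ℝ) ^ 2 := by
  have h0 : (0 : ℝ) ∈ interior (integrableExpSet id (gaussianReal 0 v)) := by
    simp [integrableExpSet_id_gaussianReal]
  have h1 := iteratedDeriv_mgf_zero h0 4
  have hm : mgf id (gaussianReal 0 v) = fun t => rexp ((v : ℝ) * t ^ 2 / 2) := by
    rw [mgf_id_gaussianReal]; simp
  have hv : ∀ c t : ℝ, HasDerivAt (fun t : ℝ => c * t) c t := fun c t => by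
    simpa using (hasDerivAt_id t).const_mul c
  have key : ∀ (f f' : ℝ → ℝ), (∀ t, HasDerivAt f (f' t) t) →
      deriv (fun t => f t * rexp ((v : ℝ) * t ^ 2 / 2))
        = fun t => (f' t + f t * (v * t)) * rexp ((v : ℝ) * t ^ 2 / 2) := by
    intro f f' hf
    funext t
    have h2 : HasDerivAt (fun t : ℝ => (v : ℝ) * t ^ 2 / 2) ((v : ℝ) * t) t := by
      refine (((hasDerivAt_pow 2 t).const_mul (v : ℝ)).div_const 2).congr_deriv ?_
      norm_num
      ring
    rw [((hf t).fun_mul h2.exp).deriv]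
    ring
  have e : (fun t : ℝ => rexp ((v : ℝ) * t ^ 2 / 2))
      = fun t => (fun _ => (1 : ℝ)) t * rexp ((v : ℝ) * t ^ 2 / 2) := by simp
  have d1 := key (fun _ => 1) (fun _ => 0) (fun t => hasDerivAt_const t 1)
  have d2 := key (fun t => v * t) (fun _ => v) (hv v)
  have d3 := key (fun t => v + (v * t) * (v * t)) (fun t => 2 * (v : ℝ) ^ 2 * t)
    (fun t => (((hv v t).fun_mul (hv v t)).const_add (v : ℝ)).congr_deriv (by ring))
  have d4 := key (fun t => 2 * (v : ℝ) ^ 2 * t + (v + (v * t) * (v * t)) * (v * t))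
    (fun t => 3 * (v : ℝ) ^ 2 + 3 * (v : ℝ) ^ 3 * t ^ 2)
    (fun t => ((hv (2 * (v : ℝ) ^ 2) t).fun_add
      ((((hv v t).fun_mul (hv v t)).const_add (v : ℝ)).fun_mul (hv v t))).congr_deriv (by ring))
  rw [hm] at h1
  simp only [iteratedDeriv_succ, iteratedDeriv_zero] at h1
  rw [e, d1] at h1
  simp only [zero_add, one_mul] at h1
  rw [d2, d3, d4] at h1
  simpa using h1.symm

/-- A real random variable with a centered (possibly degenerate) Gaussian law. -/
def IsCenteredGaussian (P : Measure Ω) (Z : Ω → ℝ) : Prop :=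
  ∃ v : NNReal, P.map Z = gaussianReal 0 v

namespace IsCenteredGaussian

variable {P : Measure Ω} {X Y Z : Ω → ℝ}

lemma aemeasurable (hZ : IsCenteredGaussian P Z) : AEMeasurable Z P := by
  obtain ⟨v, hv⟩ := hZ
  exact AEMeasurable.of_map_ne_zero (hv ▸ IsProbabilityMeasure.ne_zero _)

lemma memLp (hZ : IsCenteredGaussian P Z) (p : NNReal) : MemLp Z p P := by
  have hm := hZ.aemeasurable
  obtain ⟨v, hv⟩ := hZ
  have h := memLp_id_gaussianReal (μ := 0) (v := v) p
  rw [← hv, memLp_map_measure_iff aestronglyMeasurable_id hm] at h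
  exact h

lemma integral_eq_zero (hZ : IsCenteredGaussian P Z) : ∫ ω, Z ω ∂P = 0 := by
  have hm := hZ.aemeasurable
  obtain ⟨v, hv⟩ := hZ
  have h := integral_map hm (f := fun x : ℝ => x) aestronglyMeasurable_id
  rw [hv, integral_id_gaussianReal] at h
  exact h.symm

lemma integral_pow_four (hZ : IsCenteredGaussian P Z) :
    ∫ ω, Z ω ^ 4 ∂P = 3 * (∫ ω, Z ω ^ 2 ∂P) ^ 2 := by
  have hm := hZ.aemeasurable
  obtain ⟨v, hv⟩ := hZ
  have h4 := integral_map hm (f := fun x : ℝ => x ^ 4)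
    (by fun_prop)
  have h2 := integral_map hm (f := fun x : ℝ => x ^ 2)
    (by fun_prop)
  have hv2 : ∫ x, x ^ 2 ∂(gaussianReal 0 v) = v := by
    have := variance_id_gaussianReal (μ := 0) (v := v)
    rw [variance_eq_integral aemeasurable_id] at this
    simpa [integral_id_gaussianReal] using this
  rw [← h4, ← h2, hv, hv2, integral_pow_four_gaussianReal]

lemma integrable_pow_four (hZ : IsCenteredGaussian P Z) : Integrable (fun ω => Z ω ^ 4) P := by
  have := (hZ.memLp 4).integrable_norm_pow (p := 4) (by norm_num)
  simpa [Even.pow_abs (by decide : Even 4)] using this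

/-- Isserlis' formula for two squares. -/
lemma integral_sq_mul_sq (hX : IsCenteredGaussian P X) (hY : IsCenteredGaussian P Y)
    (hadd : IsCenteredGaussian P (X + Y)) (hsub : IsCenteredGaussian P (X - Y)) :
    ∫ ω, X ω ^ 2 * Y ω ^ 2 ∂P
      = (∫ ω, X ω ^ 2 ∂P) * (∫ ω, Y ω ^ 2 ∂P) + 2 * (∫ ω, X ω * Y ω ∂P) ^ 2 := by
  have i4 : ∀ {Z : Ω → ℝ}, IsCenteredGaussian P Z → Integrable (fun ω => Z ω ^ 4) P :=
    integrable_pow_four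
  have i2 : ∀ {Z : Ω → ℝ}, IsCenteredGaussian P Z → Integrable (fun ω => Z ω ^ 2) P := by
    intro Z hZ
    exact (hZ.memLp 2).integrable_sq
  have iXY : Integrable (fun ω => X ω * Y ω) P :=
    MemLp.integrable_mul (p := 2) (q := 2) (hX.memLp 2) (hY.memLp 2)
  have e1 : (∫ ω, (X + Y) ω ^ 4 ∂P) + (∫ ω, (X - Y) ω ^ 4 ∂P)
      = 2 * (∫ ω, X ω ^ 4 ∂P) + 12 * (∫ ω, X ω ^ 2 * Y ω ^ 2 ∂P) + 2 * (∫ ω, Y ω ^ 4 ∂P) := by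
    have iXY2 : Integrable (fun ω => X ω ^ 2 * Y ω ^ 2) P := by
      refine ((((i4 hadd).add (i4 hsub)).sub (((i4 hX).add (i4 hY)).const_mul 2)).div_const
        12).congr (ae_of_all _ fun ω => ?_)
      simp only [Pi.add_apply, Pi.sub_apply]
      ring
    rw [← integral_add (i4 hadd) (i4 hsub), ← integral_const_mul, ← integral_const_mul,
      ← integral_const_mul, ← integral_add ((i4 hX).const_mul 2) (iXY2.const_mul 12),
      ← integral_add (((i4 hX).const_mul 2).fun_add (iXY2.const_mul 12)) ((i4 hY).const_mul 2)]
    congr 1; funext ω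
    simp only [Pi.add_apply, Pi.sub_apply]
    ring
  have e2 : ∫ ω, (X + Y) ω ^ 2 ∂P
      = (∫ ω, X ω ^ 2 ∂P) + 2 * (∫ ω, X ω * Y ω ∂P) + ∫ ω, Y ω ^ 2 ∂P := by
    rw [← integral_const_mul, ← integral_add (i2 hX) (iXY.const_mul 2),
      ← integral_add ((i2 hX).fun_add (iXY.const_mul 2)) (i2 hY)]
    congr 1; funext ω
    simp only [Pi.add_apply]
    ring
  have e3 : ∫ ω, (X - Y) ω ^ 2 ∂P
      = (∫ ω, X ω ^ 2 ∂P) - 2 * (∫ ω, X ω * Y ω ∂P) + ∫ ω, Y ω ^ 2 ∂P := by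
    rw [← integral_const_mul, ← integral_sub (i2 hX) (iXY.const_mul 2),
      ← integral_add (f := fun ω => X ω ^ 2 - 2 * (X ω * Y ω)) ((i2 hX).sub (iXY.const_mul 2))
        (i2 hY)]
    congr 1; funext ω
    simp only [Pi.sub_apply]
    ring
  rw [hadd.integral_pow_four, hsub.integral_pow_four, hX.integral_pow_four, hY.integral_pow_four,
    e2, e3] at e1
  linarith

/-- Almost sure limits of centered Gaussian variables are centered Gaussian. -/
lemma of_tendsto [IsProbabilityMeasure P] {S : ℕ → Ω → ℝ} (hS : ∀ n, IsCenteredGaussian P (S n))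
    (hZ : AEMeasurable Z P) (hlim : ∀ᵐ ω ∂P, Tendsto (fun n => S n ω) atTop (𝓝 (Z ω))) :
    IsCenteredGaussian P Z := by
  have hSm := fun n => (hS n).aemeasurable
  choose v hv using hS
  have : IsProbabilityMeasure (P.map Z) := Measure.isProbabilityMeasure_map hZ
  have hchar : ∀ t : ℝ, Tendsto (fun n => ((rexp (-(v n * t ^ 2 / 2)) : ℝ) : ℂ)) atTop
      (𝓝 (charFun (P.map Z) t)) := by
    intro t
    have h1 : ∀ n, ((rexp (-(v n * t ^ 2 / 2)) : ℝ) : ℂ)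
        = ∫ ω, Complex.exp (t * S n ω * Complex.I) ∂P := by
      intro n
      have := charFun_apply_real (μ := P.map (S n)) t
      rw [integral_map (hSm n) (by fun_prop), hv n, charFun_gaussianReal] at this
      rw [← this]
      push_cast
      congr 1
      simp
    rw [charFun_apply_real, integral_map hZ (by fun_prop)]
    simp_rw [h1]
    refine tendsto_integral_of_dominated_convergence (fun _ => (1 : ℝ)) (fun n => ?_)
      (integrable_const _) (fun n => ?_) ?_
    · have := hSm n
      exact (by fun_prop : AEMeasurable _ P).aestronglyMeasurable
    · filter_upwards with ω
      rw [← Complex.ofReal_mul, Complex.norm_exp_ofReal_mul_I]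
    · filter_upwards [hlim] with ω hω
      have hc : Continuous fun x : ℝ => Complex.exp (t * x * Complex.I) := by fun_prop
      exact (hc.tendsto (Z ω)).comp hω
  have hre : ∀ t : ℝ, Tendsto (fun n => rexp (-(v n * t ^ 2 / 2))) atTop
      (𝓝 (charFun (P.map Z) t).re) := fun t =>
    ((Complex.continuous_re.tendsto _).comp (hchar t)).congr fun n => Complex.ofReal_re _
  have hcharre : ∀ t : ℝ, charFun (P.map Z) t = ((charFun (P.map Z) t).re : ℂ) := fun t =>
    tendsto_nhds_unique (hchar t) ((Complex.continuous_ofReal.tendsto _).comp (hre t))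
  obtain ⟨s, hs0, hs⟩ : ∃ s : ℝ, s ≠ 0 ∧ charFun (P.map Z) s ≠ 0 := by
    have hcont : Continuous (charFun (P.map Z)) := continuous_charFun
    have h0 : charFun (P.map Z) 0 ≠ 0 := by simp
    have := (hcont.continuousAt (x := 0)).eventually_ne h0
    obtain ⟨s, hs, hs'⟩ := ((this.filter_mono nhdsWithin_le_nhds).and
      (self_mem_nhdsWithin : {(0 : ℝ)}ᶜ ∈ 𝓝[≠] (0 : ℝ))).exists
    exact ⟨s, hs', hs⟩
  have hsre : (charFun (P.map Z) s).re ≠ 0 := fun h => hs (by rw [hcharre s, h]; simp)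
  have hlog := (hre s).log hsre
  simp only [Real.log_exp] at hlog
  have hvlim : Tendsto (fun n => (v n : ℝ)) atTop
      (𝓝 (-(2 * Real.log (charFun (P.map Z) s).re / s ^ 2))) := by
    have := (hlog.const_mul 2).div_const (s ^ 2) |>.neg
    refine this.congr fun n => ?_
    field_simp
  have hnn : 0 ≤ -(2 * Real.log (charFun (P.map Z) s).re / s ^ 2) :=
    ge_of_tendsto' hvlim fun n => (v n).2
  obtain ⟨w, hw⟩ : ∃ w : NNReal, (w : ℝ) = -(2 * Real.log (charFun (P.map Z) s).re / s ^ 2) :=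
    ⟨⟨_, hnn⟩, rfl⟩
  rw [← hw] at hvlim
  refine ⟨w, Measure.ext_of_charFun (funext fun t => ?_)⟩
  have h2 : Tendsto (fun n => rexp (-(v n * t ^ 2 / 2))) atTop _ :=
    (Real.continuous_exp.tendsto _).comp ((hvlim.mul_const (t ^ 2)).div_const 2).neg
  rw [hcharre t, tendsto_nhds_unique (hre t) h2, charFun_gaussianReal]
  push_cast
  congr 1
  simp

end IsCenteredGaussian

/-- Partial sums of `(n + 1) ^ (-δ)` grow at most like `N ^ (1 - δ)`. -/
lemma sum_range_rpow_neg_le {δ : ℝ} (h0 : 0 < δ) (h1 : δ < 1) (N : ℕ) :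
    ∑ n ∈ Finset.range N, ((n : ℝ) + 1) ^ (-δ) ≤ (N : ℝ) ^ (1 - δ) / (1 - δ) := by
  have hs : 0 < 1 - δ := by linarith
  induction N with
  | zero => simp [Real.zero_rpow hs.ne']
  | succ N ih =>
    rw [Finset.sum_range_succ]
    have hN : (0 : ℝ) < N + 1 := by positivity
    have hb := rpow_one_add_le_one_add_mul_self (s := -(1 / ((N : ℝ) + 1)))
      (by rw [neg_le_neg_iff, div_le_one hN]; linarith [Nat.cast_nonneg (α := ℝ) N])
      hs.le (by linarith : 1 - δ ≤ 1)
    have e1 : (N : ℝ) = (N + 1) * (1 + -(1 / ((N : ℝ) + 1))) := by field_simp; ring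
    have e0 : 0 ≤ 1 + -(1 / ((N : ℝ) + 1)) := by
      have : 1 / ((N : ℝ) + 1) ≤ 1 := by
        rw [div_le_one hN]; linarith [Nat.cast_nonneg (α := ℝ) N]
      linarith
    have e2 : (N : ℝ) ^ (1 - δ) ≤ ((N : ℝ) + 1) ^ (1 - δ) - (1 - δ) * ((N : ℝ) + 1) ^ (-δ) := by
      calc (N : ℝ) ^ (1 - δ)
          = ((N : ℝ) + 1) ^ (1 - δ) * (1 + -(1 / ((N : ℝ) + 1))) ^ (1 - δ) := by
            rw [← Real.mul_rpow hN.le e0, ← e1]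
        _ ≤ ((N : ℝ) + 1) ^ (1 - δ) * (1 + (1 - δ) * -(1 / ((N : ℝ) + 1))) := by gcongr
        _ = _ := by
          have : ((N : ℝ) + 1) ^ (1 - δ) = ((N : ℝ) + 1) * ((N : ℝ) + 1) ^ (-δ) := by
            rw [sub_eq_add_neg, Real.rpow_add hN, Real.rpow_one]
          rw [this]
          field_simp
          ring
    have e3 : (N : ℝ) ^ (1 - δ) / (1 - δ)
        ≤ ((N : ℝ) + 1) ^ (1 - δ) / (1 - δ) - ((N : ℝ) + 1) ^ (-δ) := by
      rw [div_le_iff₀ hs, sub_mul, div_mul_cancel₀ _ hs.ne']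
      linarith
    push_cast
    linarith

/-- A strictly positive power of `⌊c ^ n⌋₊` has summable reciprocals when `1 < c`. -/
lemma summable_floor_pow_rpow_neg {c δ : ℝ} (hc : 1 < c) (hδ : 0 < δ) :
    Summable fun n : ℕ => (⌊c ^ n⌋₊ : ℝ) ^ (-δ) := by
  have hq : c ^ (-δ) < 1 := Real.rpow_lt_one_of_one_lt_of_neg hc (by linarith)
  have hg := (summable_geometric_of_lt_one (by positivity) hq).mul_left ((2 : ℝ) ^ δ)
  refine Summable.of_nonneg_of_le (fun n => by positivity) (fun n => ?_) hg
  have hcn : 1 ≤ c ^ n := one_le_pow₀ hc.le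
  have hf : 1 ≤ (⌊c ^ n⌋₊ : ℝ) := by exact_mod_cast Nat.floor_pos.mpr hcn
  have hlt := Nat.lt_floor_add_one (c ^ n)
  calc (⌊c ^ n⌋₊ : ℝ) ^ (-δ) ≤ (c ^ n / 2) ^ (-δ) :=
        Real.rpow_le_rpow_of_nonpos (by positivity) (by linarith) (by linarith)
    _ = 2 ^ δ * (c ^ (-δ)) ^ n := by
      rw [Real.div_rpow (by positivity) (by norm_num), Real.rpow_neg (by norm_num : (0 : ℝ) ≤ 2),
        div_inv_eq_mul, mul_comm, ← Real.rpow_natCast c n, ← Real.rpow_mul (by positivity),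
        ← Real.rpow_natCast (c ^ (-δ)) n, ← Real.rpow_mul (by positivity), mul_comm (n : ℝ)]

/-- A sequence whose second moments are summable tends to zero almost surely. -/
lemma ae_tendsto_zero_of_summable_integral_sq {P : Measure Ω} {Z : ℕ → Ω → ℝ} {B : ℕ → ℝ}
    (hZ : ∀ n, MemLp (Z n) 2 P) (hB : ∀ n, ∫ ω, Z n ω ^ 2 ∂P ≤ B n) (hsum : Summable B) :
    ∀ᵐ ω ∂P, Tendsto (fun n => Z n ω) atTop (𝓝 0) := by
  have hB0 : ∀ n, 0 ≤ B n := fun n => (integral_nonneg fun ω => sq_nonneg _).trans (hB n)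
  have hmeas : ∀ n, AEMeasurable (fun ω => ENNReal.ofReal (Z n ω ^ 2)) P := fun n =>
    ((hZ n).aemeasurable.pow_const 2).ennreal_ofReal
  have hfin : ∫⁻ ω, ∑' n, ENNReal.ofReal (Z n ω ^ 2) ∂P ≠ ⊤ := by
    rw [lintegral_tsum hmeas]
    refine ne_top_of_le_ne_top ?_ (ENNReal.tsum_le_tsum (g := fun n => ENNReal.ofReal (B n))
      fun n => ?_)
    · rw [← ENNReal.ofReal_tsum_of_nonneg hB0 hsum]
      exact ENNReal.ofReal_ne_top
    · rw [← ofReal_integral_eq_lintegral_ofReal (hZ n).integrable_sq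
        (ae_of_all _ fun ω => sq_nonneg _)]
      exact ENNReal.ofReal_le_ofReal (hB n)
  filter_upwards [ae_lt_top' (AEMeasurable.tsum hmeas) hfin] with ω hω
  have h1 := ENNReal.tendsto_atTop_zero_of_tsum_ne_top hω.ne
  have h2 := (ENNReal.tendsto_toReal ENNReal.zero_ne_top).comp h1
  have h3 : Tendsto (fun n => Z n ω ^ 2) atTop (𝓝 0) := by
    simpa [Function.comp_def, ENNReal.toReal_ofReal (sq_nonneg _)] using h2
  rw [tendsto_zero_iff_abs_tendsto_zero]
  simpa [Function.comp_def, Real.sqrt_sq_eq_abs] using h3.sqrt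

/-- Growth of the second moment of the partial sums of a sequence with polynomially decaying
covariances. -/
lemma integral_sum_sq_le {P : Measure Ω} {Y : ℕ → Ω → ℝ} {K δ : ℝ} (hK : 0 ≤ K)
    (h0 : 0 < δ) (h1 : δ < 1) (hY : ∀ k, MemLp (Y k) 2 P)
    (hcov : ∀ k n, ∫ ω, Y k ω * Y (k + n) ω ∂P ≤ K * ((n : ℝ) + 1) ^ (-δ)) (N : ℕ) :
    ∫ ω, (∑ k ∈ Finset.range N, Y k ω) ^ 2 ∂P
      ≤ 2 * K / (1 - δ) * ((N : ℝ) * (N : ℝ) ^ (1 - δ)) := by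
  have hs : 0 < 1 - δ := by linarith
  induction N with
  | zero => simp
  | succ N ih =>
    have hS : MemLp (fun ω => ∑ k ∈ Finset.range N, Y k ω) 2 P :=
      memLp_finsetSum _ fun k _ => hY k
    have hprod : ∀ k l, Integrable (fun ω => Y k ω * Y l ω) P := fun k l =>
      MemLp.integrable_mul (p := 2) (q := 2) (hY k) (hY l)
    have hSY : Integrable (fun ω => ∑ k ∈ Finset.range N, Y k ω * Y N ω) P :=
      integrable_finsetSum _ fun k _ => hprod k N
    have e : ∫ ω, (∑ k ∈ Finset.range (N + 1), Y k ω) ^ 2 ∂P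
        = (∫ ω, (∑ k ∈ Finset.range N, Y k ω) ^ 2 ∂P)
          + 2 * (∑ k ∈ Finset.range N, ∫ ω, Y k ω * Y N ω ∂P) + ∫ ω, Y N ω * Y N ω ∂P := by
      rw [← integral_finsetSum _ (fun k _ => hprod k N), ← integral_const_mul,
        ← integral_add hS.integrable_sq (hSY.const_mul 2),
        ← integral_add (hS.integrable_sq.fun_add (hSY.const_mul 2)) (hprod N N)]
      congr 1; funext ω
      rw [Finset.sum_range_succ, ← Finset.sum_mul]
      ring
    have hc : 2 * (∑ k ∈ Finset.range N, ∫ ω, Y k ω * Y N ω ∂P) + ∫ ω, Y N ω * Y N ω ∂P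
        ≤ 2 * ∑ n ∈ Finset.range (N + 1), K * ((n : ℝ) + 1) ^ (-δ) := by
      have hle : ∑ k ∈ Finset.range (N + 1), ∫ ω, Y k ω * Y N ω ∂P
          ≤ ∑ n ∈ Finset.range (N + 1), K * ((n : ℝ) + 1) ^ (-δ) := by
        rw [← Finset.sum_flip (n := N) (fun n : ℕ => K * ((n : ℝ) + 1) ^ (-δ))]
        refine Finset.sum_le_sum fun k hk => ?_
        have := hcov k (N - k)
        rwa [Nat.add_sub_cancel' (Nat.lt_succ_iff.mp (Finset.mem_range.mp hk))] at this
      have hnn : 0 ≤ ∫ ω, Y N ω * Y N ω ∂P := integral_nonneg fun ω => mul_self_nonneg _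
      rw [Finset.sum_range_succ] at hle
      linarith
    rw [← Finset.mul_sum] at hc
    have hsum := sum_range_rpow_neg_le h0 h1 (N + 1)
    have hmono : (N : ℝ) ^ (1 - δ) ≤ ((N + 1 : ℕ) : ℝ) ^ (1 - δ) :=
      Real.rpow_le_rpow (by positivity) (by push_cast; linarith) hs.le
    set R := ((N + 1 : ℕ) : ℝ) ^ (1 - δ) with hR
    have hKs : 0 ≤ 2 * K / (1 - δ) := by positivity
    calc ∫ ω, (∑ k ∈ Finset.range (N + 1), Y k ω) ^ 2 ∂P
        ≤ 2 * K / (1 - δ) * ((N : ℝ) * (N : ℝ) ^ (1 - δ)) + 2 * (K * (R / (1 - δ))) := by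
          rw [e]
          have := mul_le_mul_of_nonneg_left hsum hK
          linarith
      _ ≤ 2 * K / (1 - δ) * ((N : ℝ) * R) + 2 * (K * (R / (1 - δ))) := by gcongr
      _ = 2 * K / (1 - δ) * (((N + 1 : ℕ) : ℝ) * R) := by push_cast; ring

/-- Strong law of large numbers for nonnegative variables with common mean and polynomially
decaying covariances. -/
theorem strong_law_of_covariance_decay {P : Measure Ω} [IsProbabilityMeasure P]
    {X : ℕ → Ω → ℝ} {m K δ : ℝ} (hK : 0 ≤ K) (h0 : 0 < δ) (h1 : δ < 1)
    (hX : ∀ k, MemLp (X k) 2 P) (hnn : ∀ k ω, 0 ≤ X k ω)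
    (hcov : ∀ k n, ∫ ω, (X k ω - m) * (X (k + n) ω - m) ∂P ≤ K * ((n : ℝ) + 1) ^ (-δ)) :
    ∀ᵐ ω ∂P, Tendsto (fun N : ℕ => (∑ k ∈ Finset.range N, X k ω) / N) atTop (𝓝 m) := by
  have hs : 0 < 1 - δ := by linarith
  have hY : ∀ k, MemLp (fun ω => X k ω - m) 2 P := fun k => (hX k).sub (memLp_const m)
  let c : ℕ → ℝ := fun k => 1 + 1 / ((k : ℝ) + 1)
  have hc : ∀ k, 1 < c k := fun k => by
    have : 0 < 1 / ((k : ℝ) + 1) := by positivity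
    simp only [c]; linarith
  have hclim : Tendsto c atTop (𝓝 1) := by
    simpa [c] using (tendsto_one_div_add_atTop_nhds_zero_nat (𝕜 := ℝ)).const_add 1
  have hsub : ∀ᵐ ω ∂P, ∀ k, Tendsto (fun n : ℕ =>
      (∑ i ∈ Finset.range ⌊c k ^ n⌋₊, (X i ω - m)) / (⌊c k ^ n⌋₊ : ℝ)) atTop (𝓝 0) := by
    rw [ae_all_iff]
    intro k
    refine ae_tendsto_zero_of_summable_integral_sq
      (B := fun n => 2 * K / (1 - δ) * (⌊c k ^ n⌋₊ : ℝ) ^ (-δ)) (fun n => ?_) (fun n => ?_)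
      ((summable_floor_pow_rpow_neg (hc k) h0).mul_left _)
    · simp_rw [div_eq_mul_inv]
      exact (memLp_finsetSum _ fun i _ => hY i).mul_const _
    · have hN : (0 : ℝ) < (⌊c k ^ n⌋₊ : ℝ) := by
        exact_mod_cast Nat.floor_pos.mpr (one_le_pow₀ (hc k).le)
      simp_rw [div_pow]
      rw [integral_div, div_le_iff₀ (by positivity)]
      refine (integral_sum_sq_le hK h0 h1 hY hcov _).trans_eq ?_
      rw [sub_eq_add_neg, Real.rpow_add hN, Real.rpow_one]
      ring
  filter_upwards [hsub] with ω hω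
  refine tendsto_div_of_monotone_of_tendsto_div_floor_pow _ m ?_ c hc hclim fun k => ?_
  · exact monotone_nat_of_le_succ fun n => by
      rw [Finset.sum_range_succ]; linarith [hnn n ω]
  · have := (hω k).add_const m
    rw [zero_add] at this
    refine this.congr fun n => ?_
    have hN : (⌊c k ^ n⌋₊ : ℝ) ≠ 0 := by
      exact_mod_cast (Nat.floor_pos.mpr (one_le_pow₀ (hc k).le)).ne'
    simp only [Finset.sum_sub_distrib, Finset.sum_const, Finset.card_range, nsmul_eq_mul]
    field_simp
    ring

/-- Riemann sums with left endpoints converge to the integral of a continuous function. -/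
lemma tendsto_riemann_sum {f : ℝ → ℝ} (hf : Continuous f) {L : ℝ} (hL : 0 < L) :
    Tendsto (fun n : ℕ => ∑ i ∈ Finset.range (n + 1), L / (n + 1) * f (i * (L / (n + 1))))
      atTop (𝓝 (∫ u in (0 : ℝ)..L, f u)) := by
  rw [Metric.tendsto_atTop]
  intro ε hε
  have huc := isCompact_Icc (a := (0 : ℝ)) (b := L) |>.uniformContinuousOn_of_continuous
    hf.continuousOn
  obtain ⟨δ, hδ, hd⟩ := Metric.uniformContinuousOn_iff.mp huc (ε / (2 * L)) (by positivity)
  obtain ⟨N, hN⟩ := exists_nat_gt (L / δ)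
  refine ⟨N, fun n hn => ?_⟩
  have hn1 : (0 : ℝ) < n + 1 := by positivity
  set η := L / ((n : ℝ) + 1) with hη
  have hη0 : 0 < η := by positivity
  have hηδ : η < δ := by
    rw [hη, div_lt_iff₀ hn1]
    rw [div_lt_iff₀ hδ] at hN
    have : (N : ℝ) ≤ n := by exact_mod_cast hn
    nlinarith
  have hηL : ((n : ℝ) + 1) * η = L := by rw [hη]; field_simp
  have hsplit : ∫ u in (0 : ℝ)..L, f u
      = ∑ i ∈ Finset.range (n + 1), ∫ u in (i * η)..((i + 1 : ℕ) * η), f u := by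
    rw [intervalIntegral.sum_integral_adjacent_intervals (a := fun i : ℕ => (i : ℝ) * η)
      fun k _ => hf.intervalIntegrable _ _]
    simp only [Nat.cast_zero, zero_mul, Nat.cast_add, Nat.cast_one, hηL]
  have hterm : ∀ i ∈ Finset.range (n + 1),
      |η * f (i * η) - ∫ u in (i * η)..((i + 1 : ℕ) * η), f u| ≤ ε / (2 * L) * η := by
    intro i hi
    have hi' : ((i : ℝ) + 1) ≤ n + 1 := by exact_mod_cast Finset.mem_range.mp hi
    have hiL : ((i : ℝ) + 1) * η ≤ L := hηL ▸ mul_le_mul_of_nonneg_right hi' hη0.le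
    have hi0 : 0 ≤ (i : ℝ) * η := by positivity
    have hle : (i : ℝ) * η ≤ ((i + 1 : ℕ) : ℝ) * η := by push_cast; linarith
    have hw : ((i + 1 : ℕ) : ℝ) * η - i * η = η := by push_cast; ring
    have e : η * f (i * η) - ∫ u in (i * η)..((i + 1 : ℕ) * η), f u
        = ∫ u in (i * η)..((i + 1 : ℕ) * η), (f (i * η) - f u) := by
      rw [intervalIntegral.integral_sub (by simp) (hf.intervalIntegrable _ _),
        intervalIntegral.integral_const, hw, smul_eq_mul]
    rw [e, ← Real.norm_eq_abs]
    refine (intervalIntegral.norm_integral_le_of_norm_le_const (C := ε / (2 * L))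
      fun u hu => ?_).trans_eq ?_
    · rw [Set.uIoc_of_le hle] at hu
      obtain ⟨hu1, hu2⟩ := hu
      push_cast at hu2
      have := hd (i * η) ⟨hi0, by linarith⟩ u ⟨by linarith, by linarith⟩ (by
        rw [Real.dist_eq, abs_sub_lt_iff]; constructor <;> linarith)
      rw [Real.dist_eq] at this
      exact this.le
    · rw [hw, abs_of_pos hη0]
  rw [hsplit, Real.dist_eq, ← Finset.sum_sub_distrib]
  calc |∑ i ∈ Finset.range (n + 1), (η * f (i * η) - ∫ u in (i * η)..((i + 1 : ℕ) * η), f u)|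
      ≤ ∑ i ∈ Finset.range (n + 1), ε / (2 * L) * η :=
        (Finset.abs_sum_le_sum_abs _ _).trans (Finset.sum_le_sum hterm)
    _ = ε / 2 := by
      rw [Finset.sum_const, Finset.card_range, nsmul_eq_mul, Nat.cast_add, Nat.cast_one,
        mul_left_comm, hηL]
      field_simp
    _ < ε := by linarith

/-- The integral of a path-continuous process spanning a centered Gaussian space is centered
Gaussian. -/
lemma IsCenteredGaussian.intervalIntegral {P : Measure Ω} [IsProbabilityMeasure P]
    {M : Submodule ℝ (Ω → ℝ)} (hM : ∀ Z ∈ M, IsCenteredGaussian P Z) {Y : ℝ → Ω → ℝ}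
    (hY : Measurable (Function.uncurry Y)) (hc : ∀ᵐ ω ∂P, Continuous fun t => Y t ω)
    {L : ℝ} (hL : 0 < L) (hYM : ∀ t, 0 ≤ t → Y t ∈ M) :
    IsCenteredGaussian P (fun ω => ∫ u in (0 : ℝ)..L, Y u ω) := by
  refine IsCenteredGaussian.of_tendsto
    (S := fun n => ∑ i ∈ Finset.range (n + 1), (L / (n + 1)) • Y (i * (L / (n + 1))))
    (fun n => hM _ (M.sum_mem fun i _ => M.smul_mem _ (hYM _ (by positivity)))) ?_ ?_
  · simp_rw [intervalIntegral.integral_of_le hL.le]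
    exact ((hY.comp measurable_swap).stronglyMeasurable.integral_prod_right
      (f := fun ω u => Y u ω)).measurable.aemeasurable
  · filter_upwards [hc] with ω hω
    simpa using tendsto_riemann_sum hω hL

/-- The linear span of the values of a process at nonnegative times. -/
def processSpan {Ω : Type*} (W : ℝ → Ω → ℝ) : Submodule ℝ (Ω → ℝ) :=
  Submodule.span ℝ (W '' Set.Ici 0)

lemma mem_processSpan {Ω : Type*} {W : ℝ → Ω → ℝ} {t : ℝ} (ht : 0 ≤ t) : W t ∈ processSpan W :=
  Submodule.subset_span ⟨t, ht, rfl⟩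

lemma exists_eq_of_mem_processSpan {Ω : Type*} {W : ℝ → Ω → ℝ} {Z : Ω → ℝ}
    (hZ : Z ∈ processSpan W) :
    ∃ (n : ℕ) (t : Fin n → ℝ) (c : Fin n → ℝ), (∀ i, 0 ≤ t i) ∧
      Z = fun ω => ∑ i, c i * W (t i) ω := by
  obtain ⟨n, c, g, hg⟩ := Submodule.mem_span_set'.mp hZ
  choose t ht htg using fun i => (g i).2
  refine ⟨n, t, c, ht, ?_⟩
  rw [← hg]
  funext ω
  simp [htg]

lemma IsFBM.isCenteredGaussian {P : Measure Ω} {H : ℝ} {W : ℝ → Ω → ℝ} (hW : IsFBM P H W)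
    {Z : Ω → ℝ} (hZ : Z ∈ processSpan W) : IsCenteredGaussian P Z := by
  obtain ⟨n, t, c, ht, rfl⟩ := exists_eq_of_mem_processSpan hZ
  exact hW.gaussian_fdd n t ht c

lemma indepFun_of_mem_processSpan {P : Measure Ω} {W₁ W₂ : ℝ → Ω → ℝ}
    (hIndep : IndepFun (fun ω t => W₁ t ω) (fun ω t => W₂ t ω) P) {Z₁ Z₂ : Ω → ℝ}
    (h₁ : Z₁ ∈ processSpan W₁) (h₂ : Z₂ ∈ processSpan W₂) : IndepFun Z₁ Z₂ P := by
  obtain ⟨n₁, t₁, c₁, -, rfl⟩ := exists_eq_of_mem_processSpan h₁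
  obtain ⟨n₂, t₂, c₂, -, rfl⟩ := exists_eq_of_mem_processSpan h₂
  exact hIndep.comp (φ := fun w : ℝ → ℝ => ∑ i, c₁ i * w (t₁ i))
    (ψ := fun w : ℝ → ℝ => ∑ i, c₂ i * w (t₂ i)) (by fun_prop) (by fun_prop)

lemma isCenteredGaussian_of_mem_sup {P : Measure Ω} {H₁ H₂ : ℝ} {W₁ W₂ : ℝ → Ω → ℝ}
    (hW₁ : IsFBM P H₁ W₁) (hW₂ : IsFBM P H₂ W₂)
    (hIndep : IndepFun (fun ω t => W₁ t ω) (fun ω t => W₂ t ω) P) {Z : Ω → ℝ}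
    (hZ : Z ∈ processSpan W₁ ⊔ processSpan W₂) : IsCenteredGaussian P Z := by
  obtain ⟨Z₁, h₁, Z₂, h₂, rfl⟩ := Submodule.mem_sup.mp hZ
  have hI := indepFun_of_mem_processSpan hIndep h₁ h₂
  obtain ⟨v₁, hv₁⟩ := hW₁.isCenteredGaussian h₁
  obtain ⟨v₂, hv₂⟩ := hW₂.isCenteredGaussian h₂
  exact ⟨v₁ + v₂, by simpa using gaussianReal_add_gaussianReal_of_indepFun hI hv₁ hv₂⟩

lemma continuous_abs_rpow {p : ℝ} (hp : 0 ≤ p) : Continuous fun x : ℝ => |x| ^ p :=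
  continuous_abs.rpow_const fun _ => Or.inr hp

lemma hasDerivAt_mul_abs_rpow {p : ℝ} (hp : 0 < p) (x : ℝ) :
    HasDerivAt (fun x : ℝ => x * |x| ^ p / (p + 1)) (|x| ^ p) x := by
  have hcont := continuous_abs_rpow hp.le
  refine hasDerivAt_of_hasDerivAt_of_ne' (x := 0) (fun y hy => ?_)
    (by fun_prop) hcont.continuousAt x
  have hp1 : p + 1 ≠ 0 := by positivity
  have habs : HasDerivAt (fun x : ℝ => |x| ^ p) (SignType.sign y * p * |y| ^ (p - 1)) y :=
    (hasDerivAt_abs hy).rpow_const (Or.inl (abs_ne_zero.mpr hy))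
  refine (((hasDerivAt_id y).fun_mul habs).div_const (p + 1)).congr_deriv ?_
  have h1 : y * SignType.sign y = |y| := self_mul_sign y
  have h2 : |y| ^ p = |y| * |y| ^ (p - 1) := by
    rw [← Real.rpow_one_add' (abs_nonneg y) (by linarith)]; congr 1; ring
  rw [div_eq_iff hp1]
  simp only [id_eq]
  calc 1 * |y| ^ p + y * (SignType.sign y * p * |y| ^ (p - 1))
      = |y| ^ p + p * (y * SignType.sign y) * |y| ^ (p - 1) := by ring
    _ = |y| ^ p * (p + 1) := by rw [h1, h2]; ring

lemma hasDerivAt_abs_rpow_add_two {p : ℝ} (hp : 0 < p) (x : ℝ) :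
    HasDerivAt (fun x : ℝ => |x| ^ (p + 2) / ((p + 1) * (p + 2))) (x * |x| ^ p / (p + 1)) x := by
  refine ((hasDerivAt_abs_rpow x (by linarith : 1 < p + 2)).div_const _).congr_deriv ?_
  rw [add_sub_cancel_right]
  field_simp

/-- The double integral of `|c + v - u| ^ p` over a square is a second difference of
`|x| ^ (p + 2)`. -/
lemma integral_integral_abs_rpow {p : ℝ} (hp : 0 < p) (L c : ℝ) :
    ∫ u in (0 : ℝ)..L, ∫ v in (0 : ℝ)..L, |c + (v - u)| ^ p
      = (|c + L| ^ (p + 2) + |c - L| ^ (p + 2) - 2 * |c| ^ (p + 2)) / ((p + 1) * (p + 2)) := by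
  set G : ℝ → ℝ := fun x => x * |x| ^ p / (p + 1) with hG
  set F : ℝ → ℝ := fun x => |x| ^ (p + 2) / ((p + 1) * (p + 2)) with hF
  have hcont := continuous_abs_rpow hp.le
  have hGc : Continuous G := (continuous_id.mul hcont).div_const _
  have hin : ∀ u : ℝ, ∫ v in (0 : ℝ)..L, |c + (v - u)| ^ p = G (c + L - u) - G (c - u) := by
    intro u
    have hd : ∀ v ∈ Set.uIcc 0 L, HasDerivAt (fun v => G (c + (v - u))) (|c + (v - u)| ^ p) v :=
      fun v _ => (hasDerivAt_mul_abs_rpow hp _).comp_const_add c (v - u) |>.comp_sub_const v u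
    rw [intervalIntegral.integral_eq_sub_of_hasDerivAt hd
      ((hcont.comp (by fun_prop : Continuous fun v => c + (v - u))).intervalIntegrable _ _)]
    congr 2 <;> ring
  have hout : ∀ d : ℝ, ∫ u in (0 : ℝ)..L, G (d - u) = F d - F (d - L) := by
    intro d
    have hd : ∀ x ∈ Set.uIcc (d - L) d, HasDerivAt F (G x) x :=
      fun x _ => hasDerivAt_abs_rpow_add_two hp x
    rw [intervalIntegral.integral_comp_sub_left, sub_zero,
      intervalIntegral.integral_eq_sub_of_hasDerivAt hd (hGc.intervalIntegrable _ _)]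
  simp_rw [hin]
  have hi : ∀ d : ℝ, IntervalIntegrable (fun u => G (d - u)) volume 0 L := fun d =>
    (hGc.comp (by fun_prop : Continuous fun u => d - u)).intervalIntegrable _ _
  rw [intervalIntegral.integral_sub (hi _) (hi _), hout, hout,
    add_sub_cancel_right]
  simp only [hF]
  ring

/-- The covariance at lag `x` of increments of length `L` of a fractional Brownian motion with
`p = 2H`. -/
def incrementCov (p L x : ℝ) : ℝ := (|x + L| ^ p + |x - L| ^ p - 2 * |x| ^ p) / 2

lemma continuous_incrementCov {p : ℝ} (hp : 0 ≤ p) (L : ℝ) : Continuous (incrementCov p L) := by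
  have h := continuous_abs_rpow hp
  unfold incrementCov
  exact (((h.comp (continuous_add_const L)).add (h.comp (continuous_id.sub continuous_const))).sub
    (h.const_mul 2)).div_const 2

lemma integral_integral_incrementCov {p L : ℝ} (hp : 0 < p) (hL : 0 < L) :
    ∫ u in (0 : ℝ)..L, ∫ v in (0 : ℝ)..L, incrementCov p L (v - u)
      = 4 * ((2 : ℝ) ^ p - 1) * L ^ (p + 2) / ((p + 1) * (p + 2)) := by
  have hcont := continuous_abs_rpow hp.le
  have hc2 : ∀ c : ℝ, Continuous fun x : ℝ × ℝ => |c + (x.2 - x.1)| ^ p := fun c =>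
    hcont.comp (by fun_prop : Continuous fun x : ℝ × ℝ => c + (x.2 - x.1))
  have hi : ∀ c u : ℝ, IntervalIntegrable (fun v => |c + (v - u)| ^ p) volume 0 L := fun c u =>
    ((hc2 c).comp (by fun_prop : Continuous fun v : ℝ => (u, v))).intervalIntegrable _ _
  have ho : ∀ c : ℝ, IntervalIntegrable (fun u => ∫ v in (0 : ℝ)..L, |c + (v - u)| ^ p)
      volume 0 L := fun c =>
    (intervalIntegral.continuous_parametric_intervalIntegral_of_continuous' (hc2 c) 0
      L).intervalIntegrable _ _
  have e : ∀ u v : ℝ, incrementCov p L (v - u)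
      = (|L + (v - u)| ^ p + |-L + (v - u)| ^ p - 2 * |0 + (v - u)| ^ p) / 2 := by
    intro u v
    rw [incrementCov, zero_add, add_comm L, neg_add_eq_sub]
  simp_rw [e, intervalIntegral.integral_div]
  have e2 : ∀ u : ℝ, ∫ v in (0 : ℝ)..L,
      (|L + (v - u)| ^ p + |-L + (v - u)| ^ p - 2 * |0 + (v - u)| ^ p)
      = (∫ v in (0 : ℝ)..L, |L + (v - u)| ^ p) + (∫ v in (0 : ℝ)..L, |-L + (v - u)| ^ p)
        - 2 * ∫ v in (0 : ℝ)..L, |0 + (v - u)| ^ p := by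
    intro u
    rw [intervalIntegral.integral_sub ((hi _ u).add (hi _ u)) ((hi _ u).const_mul 2),
      intervalIntegral.integral_add (hi _ u) (hi _ u), intervalIntegral.integral_const_mul]
  simp_rw [e2]
  rw [intervalIntegral.integral_sub ((ho _).add (ho _)) ((ho _).const_mul 2),
    intervalIntegral.integral_add (ho _) (ho _), intervalIntegral.integral_const_mul,
    integral_integral_abs_rpow hp, integral_integral_abs_rpow hp, integral_integral_abs_rpow hp]
  have hp2 : p + 2 ≠ 0 := by positivity
  have e3 : |L + L| ^ (p + 2) = 4 * 2 ^ p * L ^ (p + 2) := by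
    rw [← two_mul, abs_of_pos (by positivity), Real.mul_rpow (by norm_num) hL.le,
      Real.rpow_add (by norm_num), Real.rpow_two]
    ring
  have e4 : |-L - L| ^ (p + 2) = 4 * 2 ^ p * L ^ (p + 2) := by
    rw [← e3, ← abs_neg]; congr 2; ring
  rw [e3, e4]
  simp only [sub_self, neg_add_cancel, abs_zero, Real.zero_rpow hp2, abs_neg, zero_add, zero_sub,
    abs_of_pos hL]
  ring

/-- Decay of the increment covariance. -/
lemma abs_incrementCov_le {p L x : ℝ} (hp : 0 < p) (hp2 : p < 2) (hL : 0 < L) (hx : L < x) :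
    |incrementCov p L x| ≤ L ^ 2 * (x - L) ^ (p - 2) := by
  have hd : ∀ q y : ℝ, 0 < y → HasDerivAt (fun y : ℝ => y ^ q) (q * y ^ (q - 1)) y :=
    fun q y hy => Real.hasDerivAt_rpow_const (Or.inl hy.ne')
  have hd' : ∀ q y : ℝ, 0 < y → HasDerivAt (fun y : ℝ => (y + L) ^ q) (q * (y + L) ^ (q - 1)) y :=
    fun q y hy => (hd q (y + L) (by linarith)).comp_add_const y L
  obtain ⟨ξ, hξ, h1⟩ := exists_hasDerivAt_eq_slope (fun y => (y + L) ^ p - y ^ p)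
    (fun y => p * (y + L) ^ (p - 1) - p * y ^ (p - 1)) (sub_lt_self x hL)
    (fun y hy => ((hd' p y (by linarith [hy.1])).fun_sub
      (hd p y (by linarith [hy.1]))).continuousAt.continuousWithinAt)
    (fun y hy => (hd' p y (by linarith [hy.1])).fun_sub (hd p y (by linarith [hy.1])))
  have hξ0 : 0 < ξ := by linarith [hξ.1]
  obtain ⟨η, hη, h2⟩ := exists_hasDerivAt_eq_slope (fun y => y ^ (p - 1))
    (fun y => (p - 1) * y ^ (p - 1 - 1)) (lt_add_of_pos_right ξ hL)
    (fun y hy => (hd (p - 1) y (by linarith [hy.1])).continuousAt.continuousWithinAt)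
    (fun y hy => hd (p - 1) y (by linarith [hy.1]))
  rw [sub_sub_cancel, eq_div_iff hL.ne'] at h1
  rw [add_sub_cancel_left, eq_div_iff hL.ne'] at h2
  have hη0 : 0 < η := by linarith [hη.1]
  have e : incrementCov p L x = p * (p - 1) / 2 * L ^ 2 * η ^ (p - 2) := by
    rw [incrementCov, abs_of_pos (by linarith : 0 < x + L), abs_of_pos (by linarith : 0 < x - L),
      abs_of_pos (by linarith : 0 < x)]
    rw [sub_add_cancel] at h1
    have h3 : p - 1 - 1 = p - 2 := by ring
    rw [h3] at h2
    calc ((x + L) ^ p + (x - L) ^ p - 2 * x ^ p) / 2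
        = ((x + L) ^ p - x ^ p - (x ^ p - (x - L) ^ p)) / 2 := by ring
      _ = p * ((ξ + L) ^ (p - 1) - ξ ^ (p - 1)) * L / 2 := by rw [← h1]; ring
      _ = _ := by rw [← h2]; ring
  have hpow : η ^ (p - 2) ≤ (x - L) ^ (p - 2) :=
    Real.rpow_le_rpow_of_nonpos (by linarith) (by linarith [hξ.1, hη.1]) (by linarith)
  have hcoef : |p * (p - 1) / 2| ≤ 1 := by
    rw [abs_le]; constructor <;> nlinarith
  rw [e, abs_mul, abs_mul, abs_of_pos (by positivity : 0 < L ^ 2),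
    abs_of_pos (by positivity : 0 < η ^ (p - 2))]
  calc |p * (p - 1) / 2| * L ^ 2 * η ^ (p - 2) ≤ 1 * L ^ 2 * (x - L) ^ (p - 2) := by gcongr
    _ = _ := by ring

/-- Second moments of pathwise integrals of square-integrable processes. -/
lemma integral_intervalIntegral_mul {P : Measure Ω} [IsProbabilityMeasure P] {Y Z : ℝ → Ω → ℝ}
    (hY : Measurable (Function.uncurry Y)) (hZ : Measurable (Function.uncurry Z)) {L C : ℝ}
    (hL : 0 ≤ L) (hY2 : ∀ u, 0 ≤ u → MemLp (Y u) 2 P) (hZ2 : ∀ u, 0 ≤ u → MemLp (Z u) 2 P)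
    (hYC : ∀ u, 0 ≤ u → ∫ ω, Y u ω ^ 2 ∂P ≤ C) (hZC : ∀ u, 0 ≤ u → ∫ ω, Z u ω ^ 2 ∂P ≤ C) :
    ∫ ω, (∫ u in (0 : ℝ)..L, Y u ω) * (∫ v in (0 : ℝ)..L, Z v ω) ∂P
      = ∫ u in (0 : ℝ)..L, ∫ v in (0 : ℝ)..L, ∫ ω, Y u ω * Z v ω ∂P := by
  set μ : Measure ℝ := volume.restrict (Set.Ioc 0 L) with hμ
  have hμ0 : ∀ᵐ u ∂μ, 0 ≤ u :=
    (ae_restrict_mem measurableSet_Ioc).mono fun u hu => hu.1.le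
  have hmeas : Measurable fun x : (ℝ × ℝ) × Ω => Y x.1.1 x.2 * Z x.1.2 x.2 :=
    (hY.comp (by fun_prop : Measurable fun x : (ℝ × ℝ) × Ω => (x.1.1, x.2))).mul
      (hZ.comp (by fun_prop : Measurable fun x : (ℝ × ℝ) × Ω => (x.1.2, x.2)))
  have hprod : ∀ u v, 0 ≤ u → 0 ≤ v → Integrable (fun ω => Y u ω * Z v ω) P := fun u v hu hv =>
    MemLp.integrable_mul (p := 2) (q := 2) (hY2 u hu) (hZ2 v hv)
  have hbound : ∀ u v, 0 ≤ u → 0 ≤ v → ∫ ω, ‖Y u ω * Z v ω‖ ∂P ≤ C := by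
    intro u v hu hv
    have h1 := integral_mono (hprod u v hu hv).norm
      (((hY2 u hu).integrable_sq.fun_add (hZ2 v hv).integrable_sq).div_const 2) (fun ω => by
        have := two_mul_le_add_sq |Y u ω| |Z v ω|
        simp only [sq_abs] at this
        simp only [norm_mul, Real.norm_eq_abs]
        linarith)
    rw [integral_div, integral_add (hY2 u hu).integrable_sq (hZ2 v hv).integrable_sq] at h1
    linarith [hYC u hu, hZC v hv]
  have hμμ0 : ∀ᵐ x ∂(μ.prod μ), 0 ≤ x.1 ∧ 0 ≤ x.2 :=
    (Measure.quasiMeasurePreserving_fst.ae hμ0).and (Measure.quasiMeasurePreserving_snd.ae hμ0)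
  have hint : Integrable (fun x : (ℝ × ℝ) × Ω => Y x.1.1 x.2 * Z x.1.2 x.2)
      ((μ.prod μ).prod P) := by
    rw [integrable_prod_iff hmeas.aestronglyMeasurable]
    refine ⟨hμμ0.mono fun x hx => hprod _ _ hx.1 hx.2, ?_⟩
    refine Integrable.mono' (integrable_const C)
      hmeas.stronglyMeasurable.norm.integral_prod_right'.aestronglyMeasurable
      (hμμ0.mono fun x hx => ?_)
    rw [Real.norm_of_nonneg (integral_nonneg fun ω => norm_nonneg _)]
    exact hbound _ _ hx.1 hx.2
  simp_rw [intervalIntegral.integral_of_le hL, ← hμ]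
  have e1 : ∀ ω, (∫ u, Y u ω ∂μ) * (∫ v, Z v ω ∂μ)
      = ∫ x, Y x.1 ω * Z x.2 ω ∂(μ.prod μ) := fun ω =>
    (integral_prod_mul (fun u => Y u ω) (fun v => Z v ω)).symm
  simp_rw [e1]
  rw [← integral_prod _ hint.integral_prod_left]
  exact integral_integral_swap (f := fun ω (x : ℝ × ℝ) => Y x.1 ω * Z x.2 ω) hint.swap

lemma IsFBM.memLp {P : Measure Ω} {H : ℝ} {W : ℝ → Ω → ℝ} (hW : IsFBM P H W)
    {Z : Ω → ℝ} (hZ : Z ∈ processSpan W) : MemLp Z 2 P :=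
  (hW.isCenteredGaussian hZ).memLp 2

/-- Covariance of the increments of a fractional Brownian motion. -/
lemma IsFBM.integral_increment_mul {P : Measure Ω} {H : ℝ} {W : ℝ → Ω → ℝ}
    (hW : IsFBM P H W) {s t L : ℝ} (hs : 0 ≤ s) (ht : 0 ≤ t) (hL : 0 ≤ L) :
    ∫ ω, (W (s + L) ω - W s ω) * (W (t + L) ω - W t ω) ∂P = incrementCov (2 * H) L (t - s) := by
  have hi : ∀ {s t : ℝ}, 0 ≤ s → 0 ≤ t → Integrable (fun ω => W s ω * W t ω) P := fun hs ht =>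
    MemLp.integrable_mul (p := 2) (q := 2) (hW.memLp (mem_processSpan hs))
      (hW.memLp (mem_processSpan ht))
  have hsL : 0 ≤ s + L := by positivity
  have htL : 0 ≤ t + L := by positivity
  have e : ∫ ω, (W (s + L) ω - W s ω) * (W (t + L) ω - W t ω) ∂P
      = ((∫ ω, W (s + L) ω * W (t + L) ω ∂P) + ∫ ω, W s ω * W t ω ∂P)
        - ((∫ ω, W (s + L) ω * W t ω ∂P) + ∫ ω, W s ω * W (t + L) ω ∂P) := by
    rw [← integral_add (hi hsL htL) (hi hs ht), ← integral_add (hi hsL ht) (hi hs htL),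
      ← integral_sub ((hi hsL htL).fun_add (hi hs ht)) ((hi hsL ht).fun_add (hi hs htL))]
    congr 1; funext ω
    ring
  rw [e, hW.cov _ _ hsL htL, hW.cov _ _ hs ht, hW.cov _ _ hsL ht, hW.cov _ _ hs htL, incrementCov,
    add_sub_add_right_eq_sub, abs_sub_comm s t, (by ring : s + L - t = -(t - s - L)), abs_neg,
    (by ring : s - (t + L) = -(t - s + L)), abs_neg]
  ring

/-- Increments over one window, at offset `u` from the start of window `k`, of a linear combination
of two processes. -/
def mixedIncrement (W₁ W₂ : ℝ → Ω → ℝ) (α β L : ℝ) (k : ℕ) (u : ℝ) (ω : Ω) : ℝ :=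
  α * (W₁ (k * L + u + L) ω - W₁ (k * L + u) ω) + β * (W₂ (k * L + u + L) ω - W₂ (k * L + u) ω)

section MixedIncrement

variable {P : Measure Ω} {H₁ H₂ : ℝ} {W₁ W₂ : ℝ → Ω → ℝ}
  {α β L : ℝ}

lemma mixedIncrement_mem {Ω : Type*} {W₁ W₂ : ℝ → Ω → ℝ} (hL : 0 ≤ L) (k : ℕ) {u : ℝ} (hu : 0 ≤ u) :
    mixedIncrement W₁ W₂ α β L k u ∈ processSpan W₁ ⊔ processSpan W₂ := by
  have h : ∀ (W : ℝ → Ω → ℝ) (c : ℝ), (fun ω => c * (W (k * L + u + L) ω - W (k * L + u) ω))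
      ∈ processSpan W := fun W c =>
    Submodule.smul_mem _ c (Submodule.sub_mem _ (mem_processSpan (by positivity))
      (mem_processSpan (by positivity)))
  exact Submodule.add_mem_sup (h W₁ α) (h W₂ β)

lemma measurable_mixedIncrement (h₁ : Measurable (Function.uncurry W₁))
    (h₂ : Measurable (Function.uncurry W₂)) (k : ℕ) :
    Measurable (Function.uncurry (mixedIncrement W₁ W₂ α β L k)) := by
  have h : ∀ {W : ℝ → Ω → ℝ}, Measurable (Function.uncurry W) → ∀ c : ℝ,
      Measurable fun x : ℝ × Ω => W (k * L + x.1 + c) x.2 := fun hW c =>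
    hW.comp (by fun_prop : Measurable fun x : ℝ × Ω => (k * L + x.1 + c, x.2))
  have h' : ∀ {W : ℝ → Ω → ℝ}, Measurable (Function.uncurry W) →
      Measurable fun x : ℝ × Ω => W (k * L + x.1) x.2 := fun hW =>
    hW.comp (by fun_prop : Measurable fun x : ℝ × Ω => (k * L + x.1, x.2))
  exact (((h h₁ L).sub (h' h₁)).const_mul α).add (((h h₂ L).sub (h' h₂)).const_mul β)

/-- The covariance of increments of length `L` of a mixture `α W₁ + β W₂` at lag `x`. -/
def mixedCov (H₁ H₂ α β L x : ℝ) : ℝ :=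
  α ^ 2 * incrementCov (2 * H₁) L x + β ^ 2 * incrementCov (2 * H₂) L x

lemma integral_mixedIncrement_mul (hW₁ : IsFBM P H₁ W₁) (hW₂ : IsFBM P H₂ W₂)
    (hIndep : IndepFun (fun ω t => W₁ t ω) (fun ω t => W₂ t ω) P) (hL : 0 ≤ L) (k l : ℕ)
    {u v : ℝ} (hu : 0 ≤ u) (hv : 0 ≤ v) :
    ∫ ω, mixedIncrement W₁ W₂ α β L k u ω * mixedIncrement W₁ W₂ α β L l v ω ∂P
      = mixedCov H₁ H₂ α β L (l * L + v - (k * L + u)) := by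
  let D (W : ℝ → Ω → ℝ) (s : ℝ) : Ω → ℝ := fun ω => W (s + L) ω - W s ω
  have hD : ∀ (W : ℝ → Ω → ℝ) {s : ℝ}, 0 ≤ s → D W s ∈ processSpan W := fun W s hs =>
    Submodule.sub_mem _ (mem_processSpan (by positivity)) (mem_processSpan hs)
  set s := k * L + u with hs
  set t := l * L + v with ht
  have hs0 : 0 ≤ s := by positivity
  have ht0 : 0 ≤ t := by positivity
  have cross : ∀ {s t : ℝ}, 0 ≤ s → 0 ≤ t → ∫ ω, D W₁ s ω * D W₂ t ω ∂P = 0 := by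
    intro s t hs ht
    have hI := indepFun_of_mem_processSpan hIndep (hD W₁ hs) (hD W₂ ht)
    rw [hI.integral_fun_mul_eq_mul_integral (hW₁.memLp (hD W₁ hs)).aestronglyMeasurable
      (hW₂.memLp (hD W₂ ht)).aestronglyMeasurable,
      (hW₁.isCenteredGaussian (hD W₁ hs)).integral_eq_zero, zero_mul]
  have hmul : ∀ {f g : Ω → ℝ}, MemLp f 2 P → MemLp g 2 P → Integrable (fun ω => f ω * g ω) P :=
    fun hf hg => MemLp.integrable_mul (p := 2) (q := 2) hf hg
  have m₁ : ∀ {s : ℝ}, 0 ≤ s → MemLp (D W₁ s) 2 P := fun hs => hW₁.memLp (hD W₁ hs)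
  have m₂ : ∀ {s : ℝ}, 0 ≤ s → MemLp (D W₂ s) 2 P := fun hs => hW₂.memLp (hD W₂ hs)
  have e : ∫ ω, mixedIncrement W₁ W₂ α β L k u ω * mixedIncrement W₁ W₂ α β L l v ω ∂P
      = (α ^ 2 * (∫ ω, D W₁ s ω * D W₁ t ω ∂P) + β ^ 2 * ∫ ω, D W₂ s ω * D W₂ t ω ∂P)
        + (α * β * (∫ ω, D W₁ s ω * D W₂ t ω ∂P) + α * β * ∫ ω, D W₁ t ω * D W₂ s ω ∂P) := by
    have i₁ := (hmul (m₁ hs0) (m₁ ht0)).const_mul (α ^ 2)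
    have i₂ := (hmul (m₂ hs0) (m₂ ht0)).const_mul (β ^ 2)
    have i₃ := (hmul (m₁ hs0) (m₂ ht0)).const_mul (α * β)
    have i₄ := (hmul (m₁ ht0) (m₂ hs0)).const_mul (α * β)
    simp_rw [← integral_const_mul]
    rw [← integral_add i₁ i₂, ← integral_add i₃ i₄, ← integral_add (i₁.fun_add i₂) (i₃.fun_add i₄)]
    congr 1; funext ω
    simp only [mixedIncrement, D, ← hs, ← ht]
    ring
  rw [e, cross hs0 ht0, cross ht0 hs0, hW₁.integral_increment_mul hs0 ht0 hL,
    hW₂.integral_increment_mul hs0 ht0 hL, mixedCov]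
  ring

end MixedIncrement

lemma IsCenteredGaussian.congr {P : Measure Ω} {Y Z : Ω → ℝ} (hY : IsCenteredGaussian P Y)
    (h : Y =ᵐ[P] Z) : IsCenteredGaussian P Z := by
  obtain ⟨v, hv⟩ := hY
  exact ⟨v, by rw [← Measure.map_congr h, hv]⟩

/-- Strong law of large numbers for the squares of a stationary centered Gaussian sequence whose
covariance decays polynomially. -/
theorem strong_law_sq_of_gaussian {P : Measure Ω} [IsProbabilityMeasure P] {X : ℕ → Ω → ℝ}
    (hX : ∀ k, IsCenteredGaussian P (X k)) (hadd : ∀ k l, IsCenteredGaussian P (X k + X l))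
    (hsub : ∀ k l, IsCenteredGaussian P (X k - X l)) {R : ℕ → ℝ}
    (hR : ∀ k n, ∫ ω, X k ω * X (k + n) ω ∂P = R n) {C δ : ℝ} (h0 : 0 < δ) (h1 : δ < 1)
    (hC : ∀ n : ℕ, |R n| ≤ C * ((n : ℝ) + 1) ^ (-δ)) :
    ∀ᵐ ω ∂P, Tendsto (fun N : ℕ => (∑ k ∈ Finset.range N, X k ω ^ 2) / N) atTop (𝓝 (R 0)) := by
  have hC0 : 0 ≤ C := by simpa using (abs_nonneg _).trans (hC 0)
  have hR0 : ∀ k, ∫ ω, X k ω ^ 2 ∂P = R 0 := fun k => by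
    simp_rw [← hR k 0, add_zero, sq]
  have hsq : ∀ k, MemLp (fun ω => X k ω ^ 2) 2 P := fun k => by
    refine (memLp_two_iff_integrable_sq ((hX k).aemeasurable.pow_const 2).aestronglyMeasurable).2 ?_
    simpa only [← pow_mul] using (hX k).integrable_pow_four
  have hint : ∀ k, Integrable (fun ω => X k ω ^ 2) P := fun k => ((hX k).memLp 2).integrable_sq
  refine strong_law_of_covariance_decay (K := 2 * C * C) (by positivity) h0 h1 hsq
    (fun k ω => sq_nonneg _) fun k n => ?_
  have hmul : Integrable (fun ω => X k ω ^ 2 * X (k + n) ω ^ 2) P :=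
    MemLp.integrable_mul (p := 2) (q := 2) (hsq k) (hsq (k + n))
  have e : ∫ ω, (X k ω ^ 2 - R 0) * (X (k + n) ω ^ 2 - R 0) ∂P = 2 * R n ^ 2 := by
    have e1 : ∀ ω, (X k ω ^ 2 - R 0) * (X (k + n) ω ^ 2 - R 0)
        = X k ω ^ 2 * X (k + n) ω ^ 2 - (R 0 * X k ω ^ 2 + (R 0 * X (k + n) ω ^ 2 - R 0 ^ 2)) :=
      fun ω => by ring
    simp_rw [e1]
    have i1 : Integrable (fun ω => R 0 * X (k + n) ω ^ 2 - R 0 ^ 2) P :=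
      ((hint _).const_mul _).sub (integrable_const _)
    rw [integral_sub hmul (((hint k).const_mul _).fun_add i1),
      integral_add ((hint k).const_mul _) i1,
      integral_sub ((hint _).const_mul _) (integrable_const _), integral_const_mul,
      integral_const_mul, hR0, hR0, integral_const,
      (hX k).integral_sq_mul_sq (hX (k + n)) (hadd _ _) (hsub _ _), hR0, hR0, hR]
    simp
    ring
  rw [e, ← sq_abs]
  have hb : ((n : ℝ) + 1) ^ (-δ) ≤ 1 :=
    Real.rpow_le_one_of_one_le_of_nonpos (by simp) (by linarith)
  have h2 : |R n| ≤ C := (hC n).trans (mul_le_of_le_one_right hC0 hb)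
  calc 2 * |R n| ^ 2 = 2 * (|R n| * |R n|) := by ring
    _ ≤ 2 * (C * (C * ((n : ℝ) + 1) ^ (-δ))) := by
        gcongr
        exact hC n
    _ = 2 * C * C * ((n : ℝ) + 1) ^ (-δ) := by ring

lemma abs_incrementCov_le_rpow_neg {H L δ : ℝ} (hH : H ∈ Set.Ioo (0 : ℝ) 1) (hL : 0 < L)
    (hδ : δ ≤ 2 - 2 * H) {n : ℕ} (hn : 3 ≤ n) {x : ℝ} (hx : (n - 1) * L ≤ x) :
    |incrementCov (2 * H) L x|
      ≤ L ^ 2 * (L / 4) ^ (2 * H - 2) * ((n : ℝ) + 1) ^ (-δ) := by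
  obtain ⟨hH0, hH1⟩ := hH
  have hn' : (3 : ℝ) ≤ n := by exact_mod_cast hn
  have hxL : (L / 4) * (n + 1) ≤ x - L := by nlinarith
  have hpos : 0 < (L / 4) * (n + 1) := by positivity
  calc |incrementCov (2 * H) L x| ≤ L ^ 2 * (x - L) ^ (2 * H - 2) :=
        abs_incrementCov_le (by linarith) (by linarith) hL (by linarith)
    _ ≤ L ^ 2 * ((L / 4) * (n + 1)) ^ (2 * H - 2) := by
        gcongr ?_ * ?_
        exact Real.rpow_le_rpow_of_nonpos hpos hxL (by linarith)
    _ = L ^ 2 * (L / 4) ^ (2 * H - 2) * ((n : ℝ) + 1) ^ (2 * H - 2) := by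
        rw [Real.mul_rpow (by positivity) (by positivity)]
        ring
    _ ≤ L ^ 2 * (L / 4) ^ (2 * H - 2) * ((n : ℝ) + 1) ^ (-δ) := by
        gcongr
        · linarith
        · linarith

/-- The covariance at lag `n` of the window integrals of `mixedIncrement`. -/
def windowCov (H₁ H₂ α β L : ℝ) (n : ℕ) : ℝ :=
  ∫ u in (0 : ℝ)..L, ∫ v in (0 : ℝ)..L, mixedCov H₁ H₂ α β L (n * L + (v - u))

lemma windowCov_zero {H₁ H₂ α β L : ℝ} (hH₁ : 0 < H₁) (hH₂ : 0 < H₂) (hL : 0 < L) :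
    windowCov H₁ H₂ α β L 0
      = α ^ 2 * (4 * ((2 : ℝ) ^ (2 * H₁) - 1) * L ^ (2 * H₁ + 2)
          / ((2 * H₁ + 1) * (2 * H₁ + 2)))
        + β ^ 2 * (4 * ((2 : ℝ) ^ (2 * H₂) - 1) * L ^ (2 * H₂ + 2)
          / ((2 * H₂ + 1) * (2 * H₂ + 2))) := by
  have c : ∀ {H : ℝ}, 0 < H → ∀ γ : ℝ, Continuous fun x : ℝ × ℝ =>
      γ ^ 2 * incrementCov (2 * H) L (x.2 - x.1) := fun hH γ =>
    ((continuous_incrementCov (by positivity) L).comp (by fun_prop)).const_mul _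
  have c' : ∀ {H : ℝ}, 0 < H → ∀ γ u : ℝ, Continuous fun v : ℝ =>
      γ ^ 2 * incrementCov (2 * H) L (v - u) := fun hH γ u => by
    have := continuous_incrementCov (mul_pos two_pos hH).le L
    fun_prop
  have d : ∀ {H : ℝ}, 0 < H → ∀ γ : ℝ, Continuous fun u : ℝ =>
      ∫ v in (0 : ℝ)..L, γ ^ 2 * incrementCov (2 * H) L (v - u) := fun hH γ =>
    intervalIntegral.continuous_parametric_intervalIntegral_of_continuous' (c hH γ) 0 L
  simp only [windowCov, mixedCov, Nat.cast_zero, zero_mul, zero_add]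
  have e : ∀ u : ℝ, ∫ v in (0 : ℝ)..L,
        (α ^ 2 * incrementCov (2 * H₁) L (v - u) + β ^ 2 * incrementCov (2 * H₂) L (v - u))
      = (∫ v in (0 : ℝ)..L, α ^ 2 * incrementCov (2 * H₁) L (v - u))
        + ∫ v in (0 : ℝ)..L, β ^ 2 * incrementCov (2 * H₂) L (v - u) := fun u =>
    intervalIntegral.integral_add ((c' hH₁ α u).intervalIntegrable 0 L)
      ((c' hH₂ β u).intervalIntegrable 0 L)
  simp_rw [e]
  rw [intervalIntegral.integral_add ((d hH₁ α).intervalIntegrable 0 L)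
    ((d hH₂ β).intervalIntegrable 0 L)]
  simp_rw [intervalIntegral.integral_const_mul]
  rw [integral_integral_incrementCov (by positivity) hL,
    integral_integral_incrementCov (by positivity) hL]

lemma abs_windowCov_le {H₁ H₂ α β L δ : ℝ} (hH₁ : H₁ ∈ Set.Ioo (0 : ℝ) 1)
    (hH₂ : H₂ ∈ Set.Ioo (0 : ℝ) 1) (hL : 0 < L) (h₁ : δ ≤ 2 - 2 * H₁) (h₂ : δ ≤ 2 - 2 * H₂)
    {n : ℕ} (hn : 3 ≤ n) :
    |windowCov H₁ H₂ α β L n|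
      ≤ (α ^ 2 * (L ^ 2 * (L / 4) ^ (2 * H₁ - 2)) + β ^ 2 * (L ^ 2 * (L / 4) ^ (2 * H₂ - 2)))
        * L * L * ((n : ℝ) + 1) ^ (-δ) := by
  set M := α ^ 2 * (L ^ 2 * (L / 4) ^ (2 * H₁ - 2)) + β ^ 2 * (L ^ 2 * (L / 4) ^ (2 * H₂ - 2))
  have hM : ∀ x, (n - 1) * L ≤ x → ‖mixedCov H₁ H₂ α β L x‖ ≤ M * ((n : ℝ) + 1) ^ (-δ) := by
    intro x hx
    rw [Real.norm_eq_abs, mixedCov]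
    refine (abs_add_le _ _).trans ?_
    rw [abs_mul, abs_mul, abs_sq, abs_sq, add_mul, mul_assoc (α ^ 2), mul_assoc (β ^ 2)]
    gcongr
    · exact abs_incrementCov_le_rpow_neg hH₁ hL h₁ hn hx
    · exact abs_incrementCov_le_rpow_neg hH₂ hL h₂ hn hx
  have hI : ∀ u ∈ Set.uIoc 0 L, ‖∫ v in (0 : ℝ)..L, mixedCov H₁ H₂ α β L (n * L + (v - u))‖
      ≤ M * ((n : ℝ) + 1) ^ (-δ) * |L - 0| := by
    intro u hu
    refine intervalIntegral.norm_integral_le_of_norm_le_const fun v hv => hM _ ?_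
    rw [Set.uIoc_of_le hL.le] at hu hv
    linarith [hu.2, hv.1]
  refine (intervalIntegral.norm_integral_le_of_norm_le_const hI).trans_eq ?_
  rw [sub_zero, abs_of_pos hL]
  ring

lemma nifBm_sub_nifBm {Ω : Type*} {W : ℝ → Ω → ℝ} {ω : Ω} (hc : Continuous fun t => W t ω)
    (L t : ℝ) :
    nifBm W L (t + L) ω - nifBm W L t ω
      = (1 / L) * ∫ u in (0 : ℝ)..L, (W (t + u + L) ω - W (t + u) ω) := by
  have h1 : Continuous fun u => W (t + u + L) ω := hc.comp (by fun_prop : Continuous (t + · + L))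
  have h2 : Continuous fun u => W (t + u) ω := hc.comp (by fun_prop : Continuous (t + ·))
  rw [intervalIntegral.integral_sub (h1.intervalIntegrable _ _) (h2.intervalIntegrable _ _)]
  simp_rw [add_right_comm t _ L]
  rw [intervalIntegral.integral_comp_add_left (fun x => W x ω) (t + L),
    intervalIntegral.integral_comp_add_left (fun x => W x ω) t, nifBm, nifBm, add_zero, add_zero]
  ring

/-- The integral of `mixedIncrement` over window `k`. -/
def mixedWindow (W₁ W₂ : ℝ → Ω → ℝ) (α β L : ℝ) (k : ℕ) (ω : Ω) : ℝ :=
  ∫ u in (0 : ℝ)..L, mixedIncrement W₁ W₂ α β L k u ω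

section MixedWindow

lemma continuous_mixedIncrement {Ω : Type*} {W₁ W₂ : ℝ → Ω → ℝ} {ω : Ω}
    (h₁ : Continuous fun t => W₁ t ω) (h₂ : Continuous fun t => W₂ t ω) (α β L : ℝ) (k : ℕ) :
    Continuous fun u => mixedIncrement W₁ W₂ α β L k u ω := by
  have h : ∀ {W : ℝ → Ω → ℝ}, (Continuous fun t => W t ω) → ∀ γ : ℝ,
      Continuous fun u => γ * (W (k * L + u + L) ω - W (k * L + u) ω) := fun hc γ =>
    ((hc.comp (by fun_prop : Continuous fun u : ℝ => k * L + u + L)).sub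
      (hc.comp (by fun_prop : Continuous fun u : ℝ => k * L + u))).const_mul γ
  exact (h h₁ α).add (h h₂ β)

lemma tXj_succ_sub_tXj {Ω : Type*} {W₁ W₂ : ℝ → Ω → ℝ} {ω : Ω}
    (h₁ : Continuous fun t => W₁ t ω) (h₂ : Continuous fun t => W₂ t ω) (a b h : ℝ) (j k : ℕ) :
    tXj W₁ W₂ a b h j (k + 1) ω - tXj W₁ W₂ a b h j k ω
      = mixedWindow W₁ W₂ (a / (j * h)) (b / (j * h)) (j * h) k ω := by
  set L : ℝ := j * h
  have hi : ∀ {W : ℝ → Ω → ℝ}, (Continuous fun t => W t ω) → ∀ γ : ℝ,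
      IntervalIntegrable (fun u => γ * (W (k * L + u + L) ω - W (k * L + u) ω)) volume 0 L :=
    fun hc γ =>
      (((hc.comp (by fun_prop : Continuous fun u : ℝ => k * L + u + L)).sub
        (hc.comp (by fun_prop : Continuous fun u : ℝ => k * L + u))).const_mul γ).intervalIntegrable
          _ _
  simp only [mixedWindow, mixedIncrement]
  rw [intervalIntegral.integral_add (hi h₁ _) (hi h₂ _), intervalIntegral.integral_const_mul,
    intervalIntegral.integral_const_mul]
  have e₁ := nifBm_sub_nifBm h₁ L (k * L)
  have e₂ := nifBm_sub_nifBm h₂ L (k * L)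
  have ek : ((k + 1 : ℕ) : ℝ) * L = k * L + L := by push_cast; ring
  simp only [tXj]
  rw [show (j : ℝ) * h = L from rfl, ek]
  linear_combination a * e₁ + b * e₂

variable {P : Measure Ω} [IsProbabilityMeasure P] {H₁ H₂ : ℝ} {W₁ W₂ : ℝ → Ω → ℝ} {α β L : ℝ}

lemma isCenteredGaussian_mixedWindow_combination (hW₁ : IsFBM P H₁ W₁) (hW₂ : IsFBM P H₂ W₂)
    (hIndep : IndepFun (fun ω t => W₁ t ω) (fun ω t => W₂ t ω) P) (hL : 0 < L) (k l : ℕ) (c : ℝ) :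
    IsCenteredGaussian P
      (mixedWindow W₁ W₂ α β L k + c • mixedWindow W₁ W₂ α β L l) := by
  have hm := measurable_mixedIncrement (α := α) (β := β) (L := L) hW₁.jointMeasurable
    hW₂.jointMeasurable
  have hc : ∀ᵐ ω ∂P, ∀ k, Continuous fun u => mixedIncrement W₁ W₂ α β L k u ω := by
    filter_upwards [hW₁.cont, hW₂.cont] with ω h₁ h₂ k
    exact continuous_mixedIncrement h₁ h₂ α β L k
  have hG := IsCenteredGaussian.intervalIntegral (L := L)
    (Y := fun u => mixedIncrement W₁ W₂ α β L k u + c • mixedIncrement W₁ W₂ α β L l u)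
    (fun Z hZ => isCenteredGaussian_of_mem_sup hW₁ hW₂ hIndep hZ)
    ((hm k).add ((hm l).const_smul c)) (hc.mono fun ω h => (h k).add ((h l).const_smul c)) hL
    fun u hu => Submodule.add_mem _ (mixedIncrement_mem hL.le k hu)
      (Submodule.smul_mem _ c (mixedIncrement_mem hL.le l hu))
  refine hG.congr (hc.mono fun ω h => ?_)
  simp only [Pi.add_apply, Pi.smul_apply, mixedWindow, smul_eq_mul]
  rw [intervalIntegral.integral_add ((h k).intervalIntegrable _ _)
    (((h l).const_mul c).intervalIntegrable _ _), intervalIntegral.integral_const_mul]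

lemma integral_mixedWindow_mul (hW₁ : IsFBM P H₁ W₁) (hW₂ : IsFBM P H₂ W₂)
    (hIndep : IndepFun (fun ω t => W₁ t ω) (fun ω t => W₂ t ω) P) (hL : 0 < L) (k n : ℕ) :
    ∫ ω, mixedWindow W₁ W₂ α β L k ω * mixedWindow W₁ W₂ α β L (k + n) ω ∂P
      = windowCov H₁ H₂ α β L n := by
  have hm := measurable_mixedIncrement (α := α) (β := β) (L := L) hW₁.jointMeasurable
    hW₂.jointMeasurable
  have h2 : ∀ k u, 0 ≤ u → MemLp (mixedIncrement W₁ W₂ α β L k u) 2 P := fun k u hu =>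
    (isCenteredGaussian_of_mem_sup hW₁ hW₂ hIndep (mixedIncrement_mem hL.le k hu)).memLp 2
  have hC : ∀ k u, 0 ≤ u →
      ∫ ω, mixedIncrement W₁ W₂ α β L k u ω ^ 2 ∂P ≤ mixedCov H₁ H₂ α β L 0 := fun k u hu => by
    simp_rw [sq]
    rw [integral_mixedIncrement_mul hW₁ hW₂ hIndep hL.le k k hu hu, sub_self]
  simp only [mixedWindow]
  rw [integral_intervalIntegral_mul (hm k) (hm (k + n)) hL.le (h2 k) (h2 (k + n)) (hC k)
    (hC (k + n)), windowCov]
  refine intervalIntegral.integral_congr fun u hu =>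
    intervalIntegral.integral_congr fun v hv => ?_
  rw [Set.uIcc_of_le hL.le] at hu hv
  rw [integral_mixedIncrement_mul hW₁ hW₂ hIndep hL.le k (k + n) hu.1 hv.1]
  congr 1
  push_cast
  ring

lemma ae_tendsto_average_mixedWindow_sq (hH₁ : H₁ ∈ Set.Ioo (0 : ℝ) 1)
    (hH₂ : H₂ ∈ Set.Ioo (0 : ℝ) 1) (hW₁ : IsFBM P H₁ W₁) (hW₂ : IsFBM P H₂ W₂)
    (hIndep : IndepFun (fun ω t => W₁ t ω) (fun ω t => W₂ t ω) P) (hL : 0 < L) :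
    ∀ᵐ ω ∂P, Tendsto
      (fun N : ℕ => (∑ k ∈ Finset.range N, mixedWindow W₁ W₂ α β L k ω ^ 2) / N) atTop
      (𝓝 (windowCov H₁ H₂ α β L 0)) := by
  have hcomb := isCenteredGaussian_mixedWindow_combination (α := α) (β := β) hW₁ hW₂ hIndep hL
  have hG : ∀ k, IsCenteredGaussian P (mixedWindow W₁ W₂ α β L k) := fun k => by
    simpa using hcomb k k 0
  have hR := integral_mixedWindow_mul (α := α) (β := β) hW₁ hW₂ hIndep hL
  set R := windowCov H₁ H₂ α β L
  have hsq : ∀ k, ∫ ω, mixedWindow W₁ W₂ α β L k ω ^ 2 ∂P = R 0 := fun k => by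
    simp_rw [← hR k 0, add_zero, sq]
  have hR0 : 0 ≤ R 0 := hsq 0 ▸ integral_nonneg fun ω => sq_nonneg _
  have hRle : ∀ n, |R n| ≤ R 0 := by
    intro n
    have i2 := fun k => ((hG k).memLp 2).integrable_sq
    have h := (hR 0 n ▸ norm_integral_le_of_norm_le (((i2 0).fun_add (i2 (0 + n))).div_const 2)
      (ae_of_all _ fun ω => by
        have := two_mul_le_add_sq |mixedWindow W₁ W₂ α β L 0 ω|
          |mixedWindow W₁ W₂ α β L (0 + n) ω|
        simp only [sq_abs] at this
        rw [norm_mul, Real.norm_eq_abs, Real.norm_eq_abs]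
        linarith) : ‖R n‖ ≤ _)
    rw [integral_div, integral_add (i2 _) (i2 _), hsq, hsq] at h
    simpa using h
  obtain ⟨δ, hδ0, hδ1, h₁, h₂⟩ : ∃ δ : ℝ, 0 < δ ∧ δ < 1 ∧ δ ≤ 2 - 2 * H₁ ∧ δ ≤ 2 - 2 * H₂ := by
    refine ⟨min (1 / 2) (min (2 - 2 * H₁) (2 - 2 * H₂)), ?_, ?_, ?_, ?_⟩
    · refine lt_min (by norm_num) (lt_min ?_ ?_)
      · linarith [hH₁.2]
      · linarith [hH₂.2]
    · exact (min_le_left _ _).trans_lt (by norm_num)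
    · exact (min_le_right _ _).trans (min_le_left _ _)
    · exact (min_le_right _ _).trans (min_le_right _ _)
  set M := (α ^ 2 * (L ^ 2 * (L / 4) ^ (2 * H₁ - 2)) + β ^ 2 * (L ^ 2 * (L / 4) ^ (2 * H₂ - 2)))
    * L * L
  have hM : 0 ≤ M := by positivity
  refine strong_law_sq_of_gaussian (C := M + 3 * R 0) hG (fun k l => by simpa using hcomb k l 1)
    (fun k l => by simpa [sub_eq_add_neg] using hcomb k l (-1)) hR hδ0 hδ1 fun n => ?_
  have hpos : 0 ≤ ((n : ℝ) + 1) ^ (-δ) := by positivity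
  rw [add_mul]
  rcases le_or_gt 3 n with hn | hn
  · exact (abs_windowCov_le hH₁ hH₂ hL h₁ h₂ hn).trans
      (le_add_of_nonneg_right (by positivity))
  · have hn' : (n : ℝ) + 1 ≤ 3 := by exact_mod_cast hn
    have h3 : 1 ≤ 3 * ((n : ℝ) + 1) ^ (-δ) := by
      have : ((n : ℝ) + 1) ^ (-1 : ℝ) ≤ ((n : ℝ) + 1) ^ (-δ) :=
        Real.rpow_le_rpow_of_exponent_le (by simp) (by linarith)
      rw [Real.rpow_neg_one] at this
      have h4 : (3 : ℝ)⁻¹ ≤ ((n : ℝ) + 1)⁻¹ := by gcongr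
      linarith
    have := mul_le_mul_of_nonneg_left h3 hR0
    nlinarith [hRle n, mul_nonneg hM hpos]

end MixedWindow

/-- For each `j ∈ {1,2,4,8}`, a.s. as `N → ∞`,
`ξ^j_N → A₁ a² (2^{2H₁}-1) j^{2H₁} + A₂ b² (2^{2H₂}-1) j^{2H₂}` with
`A_i = 2h^{2H_i}/((2H_i+1)(H_i+1))`; moreover this limit equals
`E[ξ^j_1] = E[(X̃_1^{jh} - X̃_0^{jh})²]`. -/
theorem xi_strong_law
    (P : Measure Ω) [IsProbabilityMeasure P]
    (H₁ H₂ : ℝ) (hH₁ : H₁ ∈ Set.Ioo (0:ℝ) 1) (hH₂ : H₂ ∈ Set.Ioo (0:ℝ) 1)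
    (W₁ W₂ : ℝ → Ω → ℝ) (hW₁ : IsFBM P H₁ W₁) (hW₂ : IsFBM P H₂ W₂)
    (hIndep : IndepFun (fun ω t => W₁ t ω) (fun ω t => W₂ t ω) P)
    (a b : ℝ) (ha : a ≠ 0) (hb : b ≠ 0) (h : ℝ) (hh : 0 < h)
    (j : ℕ) (hj : j ∈ ({1, 2, 4, 8} : Set ℕ)) :
    (∀ᵐ ω ∂P, Tendsto (fun N : ℕ => xiTwo W₁ W₂ a b h j N ω) atTop
      (𝓝 (2*h^(2*H₁)/((2*H₁+1)*(H₁+1)) * a^2 * ((2:ℝ)^(2*H₁) - 1) * (j:ℝ)^(2*H₁)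
        + 2*h^(2*H₂)/((2*H₂+1)*(H₂+1)) * b^2 * ((2:ℝ)^(2*H₂) - 1) * (j:ℝ)^(2*H₂)))) ∧
    2*h^(2*H₁)/((2*H₁+1)*(H₁+1)) * a^2 * ((2:ℝ)^(2*H₁) - 1) * (j:ℝ)^(2*H₁)
        + 2*h^(2*H₂)/((2*H₂+1)*(H₂+1)) * b^2 * ((2:ℝ)^(2*H₂) - 1) * (j:ℝ)^(2*H₂)
      = ∫ ω, (tXj W₁ W₂ a b h j 1 ω - tXj W₁ W₂ a b h j 0 ω)^2 ∂P := by
  have hj0 : (0 : ℝ) < j := by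
    rcases hj with rfl | rfl | rfl | rfl <;> norm_num
  have hL : 0 < (j : ℝ) * h := by positivity
  have hlim : ∀ {H : ℝ}, 0 < H → ∀ c : ℝ,
      (c / (j * h)) ^ 2 * (4 * ((2 : ℝ) ^ (2 * H) - 1) * (j * h) ^ (2 * H + 2)
          / ((2 * H + 1) * (2 * H + 2)))
        = 2 * h ^ (2 * H) / ((2 * H + 1) * (H + 1)) * c ^ 2 * ((2 : ℝ) ^ (2 * H) - 1)
          * (j : ℝ) ^ (2 * H) := by
    intro H hH c
    rw [Real.rpow_add hL, Real.rpow_two, Real.mul_rpow hj0.le hh.le]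
    field_simp
    ring
  rw [← hlim hH₁.1 a, ← hlim hH₂.1 b, ← windowCov_zero hH₁.1 hH₂.1 hL]
  have hinc : ∀ᵐ ω ∂P, ∀ k, tXj W₁ W₂ a b h j (k + 1) ω - tXj W₁ W₂ a b h j k ω
      = mixedWindow W₁ W₂ (a / (j * h)) (b / (j * h)) (j * h) k ω := by
    filter_upwards [hW₁.cont, hW₂.cont] with ω h₁ h₂ k
    exact tXj_succ_sub_tXj h₁ h₂ a b h j k
  constructor
  · filter_upwards [hinc, ae_tendsto_average_mixedWindow_sq (α := a / (j * h)) (β := b / (j * h))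
      hH₁ hH₂ hW₁ hW₂ hIndep hL] with ω hω ht
    refine ht.congr fun N => ?_
    simp only [xiTwo, hω]
    ring
  · rw [← integral_mixedWindow_mul hW₁ hW₂ hIndep hL 0 0]
    refine integral_congr_ae (hinc.mono fun ω hω => ?_)
    simp only [add_zero, ← hω 0, zero_add, sq]
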